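/- Let 𝖠 = A_sym, suppose |σ'|≤1, |σ''|≤1, c₂ > 0, max{w, ω/w + c₁γ + c₂} ≤ 1, and assume each message function ψ^{(t)} is linear (so that its Hessian bound c^{(2)} can be taken to be 0). With Z := I − c₂Δ and Δ† := Σ_{ℓ=1}^{n−1}(1/λ_ℓ)φ_ℓφ_ℓ^⊤, for all nodes v,u ∈ V, every input X, and all coordinates 1≤α,β≤d, |∂²y^{(m)}(X)/∂x_v^α∂x_u^β| ≤ γ·( m·√(d_v d_u)/(2|E|) + (1/c₂)·(Z²(I−Z^{2m})(I+Z)^{−1}Δ†)_{vu} ). -/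

import Mathlib

open scoped BigOperators

noncomputable section

namespace OSQ

variable {n d : ℕ}

/-- componentwise application of the activation function. -/
def act (σ : ℝ → ℝ) (x : EuclideanSpace ℝ (Fin d)) : EuclideanSpace ℝ (Fin d) :=
  WithLp.toLp 2 (fun i => σ (x i))

/-- node features computed by the MPNN after `t` layers. -/
def mpnn (σ : ℝ → ℝ) (𝒜 : Matrix (Fin n) (Fin n) ℝ)
    (Ω W : ℕ → EuclideanSpace ℝ (Fin d) →L[ℝ] EuclideanSpace ℝ (Fin d))
    (ψ : ℕ → EuclideanSpace ℝ (Fin d) × EuclideanSpace ℝ (Fin d) → EuclideanSpace ℝ (Fin d)) :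
    ℕ → (Fin n → EuclideanSpace ℝ (Fin d)) → Fin n → EuclideanSpace ℝ (Fin d)
  | 0, X, v => X v
  | (t+1), X, v =>
    act σ (Ω (t+1) (mpnn σ 𝒜 Ω W ψ t X v)
      + W (t+1) (∑ u : Fin n, 𝒜 v u • ψ (t+1) (mpnn σ 𝒜 Ω W ψ t X v, mpnn σ 𝒜 Ω W ψ t X u)))

/-- coordinate direction in the input space: a perturbation of entry `β` of the
feature of node `u`. -/
def dir (u : Fin n) (β : Fin d) : Fin n → EuclideanSpace ℝ (Fin d) :=
  Pi.single u (EuclideanSpace.single β 1)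

/-- `∂ h_v^{(m),α} / ∂ x_u^β`. -/
def jacEntry (σ : ℝ → ℝ) (𝒜 : Matrix (Fin n) (Fin n) ℝ)
    (Ω W : ℕ → EuclideanSpace ℝ (Fin d) →L[ℝ] EuclideanSpace ℝ (Fin d))
    (ψ : ℕ → EuclideanSpace ℝ (Fin d) × EuclideanSpace ℝ (Fin d) → EuclideanSpace ℝ (Fin d))
    (m : ℕ) (v u : Fin n) (X : Fin n → EuclideanSpace ℝ (Fin d)) (α β : Fin d) : ℝ :=
  fderiv ℝ (fun Y => mpnn σ 𝒜 Ω W ψ m Y v α) X (dir u β)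

/-- `∂² h_i^{(m),α} / ∂ x_v^β ∂ x_u^γ`. -/
def hessEntry (σ : ℝ → ℝ) (𝒜 : Matrix (Fin n) (Fin n) ℝ)
    (Ω W : ℕ → EuclideanSpace ℝ (Fin d) →L[ℝ] EuclideanSpace ℝ (Fin d))
    (ψ : ℕ → EuclideanSpace ℝ (Fin d) × EuclideanSpace ℝ (Fin d) → EuclideanSpace ℝ (Fin d))
    (m : ℕ) (i v u : Fin n) (X : Fin n → EuclideanSpace ℝ (Fin d)) (α β γ : Fin d) : ℝ :=
  fderiv ℝ (fun Y => fderiv ℝ (fun Z => mpnn σ 𝒜 Ω W ψ m Z i α) Y (dir u γ)) X (dir v β)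

/-- graph-level prediction with SUM readout: `y(X) = θᵀ Σ_v h_v^{(m)}`. -/
def readout (θ : EuclideanSpace ℝ (Fin d)) (σ : ℝ → ℝ) (𝒜 : Matrix (Fin n) (Fin n) ℝ)
    (Ω W : ℕ → EuclideanSpace ℝ (Fin d) →L[ℝ] EuclideanSpace ℝ (Fin d))
    (ψ : ℕ → EuclideanSpace ℝ (Fin d) × EuclideanSpace ℝ (Fin d) → EuclideanSpace ℝ (Fin d))
    (m : ℕ) (X : Fin n → EuclideanSpace ℝ (Fin d)) : ℝ :=
  ∑ α : Fin d, θ α * (∑ v : Fin n, mpnn σ 𝒜 Ω W ψ m X v) α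

/-- `∂² y^{(m)} / ∂ x_v^α ∂ x_u^β`. -/
def mixEntry (θ : EuclideanSpace ℝ (Fin d)) (σ : ℝ → ℝ) (𝒜 : Matrix (Fin n) (Fin n) ℝ)
    (Ω W : ℕ → EuclideanSpace ℝ (Fin d) →L[ℝ] EuclideanSpace ℝ (Fin d))
    (ψ : ℕ → EuclideanSpace ℝ (Fin d) × EuclideanSpace ℝ (Fin d) → EuclideanSpace ℝ (Fin d))
    (m : ℕ) (v u : Fin n) (X : Fin n → EuclideanSpace ℝ (Fin d)) (α β : Fin d) : ℝ :=
  fderiv ℝ (fun Y => fderiv ℝ (fun Z => readout θ σ 𝒜 Ω W ψ m Z) Y (dir u β)) X (dir v α)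

/-- the matrix `S := (ω/w)I + c₁ diag(𝒜 1) + c₂ 𝒜`. -/
def Smat (ω w c₁ c₂ : ℝ) (𝒜 : Matrix (Fin n) (Fin n) ℝ) : Matrix (Fin n) (Fin n) ℝ :=
  (ω / w) • (1 : Matrix (Fin n) (Fin n) ℝ)
    + c₁ • Matrix.diagonal (fun i => ∑ j, 𝒜 i j) + c₂ • 𝒜

/-- `diag(𝒜 1)` : the diagonal matrix of row sums. -/
def rowSumDiag (𝒜 : Matrix (Fin n) (Fin n) ℝ) : Matrix (Fin n) (Fin n) ℝ :=
  Matrix.diagonal (fun i => ∑ j, 𝒜 i j)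

/-- `diag(1ᵀ M)` : the diagonal matrix of column sums. -/
def colSumDiag (M : Matrix (Fin n) (Fin n) ℝ) : Matrix (Fin n) (Fin n) ℝ :=
  Matrix.diagonal (fun j => ∑ i, M i j)

/-- the operator (spectral) norm of a matrix, viewed as a linear map between
Euclidean spaces. -/
def matOpNorm {ι κ : Type*} [Fintype ι] [Fintype κ] [DecidableEq ι] (M : Matrix κ ι ℝ) : ℝ :=
  ‖LinearMap.toContinuousLinearMap (Matrix.toEuclideanLin M)‖


/-- the symmetrically-normalized adjacency matrix `A_sym := D^{-1/2} A D^{-1/2}`. -/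
def Asym (G : SimpleGraph (Fin n)) [DecidableRel G.Adj] : Matrix (Fin n) (Fin n) ℝ :=
  Matrix.diagonal (fun a => (Real.sqrt (G.degree a))⁻¹) * G.adjMatrix ℝ *
    Matrix.diagonal (fun a => (Real.sqrt (G.degree a))⁻¹)

/-- the random-walk normalized adjacency matrix `D^{-1} A`. -/
def Arw (G : SimpleGraph (Fin n)) [DecidableRel G.Adj] : Matrix (Fin n) (Fin n) ℝ :=
  Matrix.diagonal (fun a => ((G.degree a : ℝ))⁻¹) * G.adjMatrix ℝ
/-- the normalized graph Laplacian `Δ := I - A_sym`. -/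
def nLap (G : SimpleGraph (Fin n)) [DecidableRel G.Adj] : Matrix (Fin n) (Fin n) ℝ :=
  1 - Asym G

/-- the matrix `Z := I - c₂ Δ`. -/
def Zmat (c₂ : ℝ) (G : SimpleGraph (Fin n)) [DecidableRel G.Adj] : Matrix (Fin n) (Fin n) ℝ :=
  1 - c₂ • nLap G

/-- the commute time `τ(v,u) = 2|E| Σ_{ℓ≥1} (1/λ_ℓ)(φ_ℓ(v)/√d_v - φ_ℓ(u)/√d_u)²`,
expressed spectrally. -/
def commuteTime (G : SimpleGraph (Fin n)) [DecidableRel G.Adj]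
    (lam : Fin n → ℝ) (φ : Fin n → Fin n → ℝ) (v u : Fin n) : ℝ :=
  2 * (G.edgeFinset.card : ℝ) *
    ∑ ℓ ∈ Finset.univ.filter (fun ℓ : Fin n => (ℓ : ℕ) ≠ 0),
      (1 / lam ℓ) *
        (φ ℓ v / Real.sqrt (G.degree v) - φ ℓ u / Real.sqrt (G.degree u)) ^ 2

/-- the pseudo-inverse `Δ† := Σ_{ℓ≥1} (1/λ_ℓ) φ_ℓ φ_ℓᵀ` of the normalized Laplacian. -/
def nLapPinv (lam : Fin n → ℝ) (φ : Fin n → Fin n → ℝ) : Matrix (Fin n) (Fin n) ℝ :=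
  Matrix.of fun a b =>
    ∑ ℓ ∈ Finset.univ.filter (fun ℓ : Fin n => (ℓ : ℕ) ≠ 0), (1 / lam ℓ) * (φ ℓ a * φ ℓ b)

section helpers

variable {E : Type*} [NormedAddCommGroup E] [NormedSpace ℝ E]

lemma act_hasFDerivAt {σ : ℝ → ℝ} (hσ : ContDiff ℝ 2 σ)
    {p : E → EuclideanSpace ℝ (Fin d)} (hp : ContDiff ℝ 2 p) (b Y : E) :
    fderiv ℝ (fun Y => OSQ.act σ (p Y)) Y b
      = WithLp.toLp 2 (fun i => deriv σ (p Y i) * (fderiv ℝ p Y b) i) := by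
  have hpd : HasFDerivAt p (fderiv ℝ p Y) Y := (hp.differentiable (by norm_num) Y).hasFDerivAt
  have hpi : ∀ i, HasFDerivAt (fun Y => p Y i)
      ((EuclideanSpace.proj i : EuclideanSpace ℝ (Fin d) →L[ℝ] ℝ).comp (fderiv ℝ p Y)) Y :=
    fun i => (EuclideanSpace.proj i : EuclideanSpace ℝ (Fin d) →L[ℝ] ℝ).hasFDerivAt.comp Y hpd
  have hg : Differentiable ℝ (fun Y => OSQ.act σ (p Y)) := by
    rw [differentiable_euclidean]
    intro i
    exact (hσ.differentiable (by norm_num)).comp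
      ((differentiable_euclidean.1 (hp.differentiable (by norm_num))) i)
  ext i
  have h1 : HasFDerivAt (fun Y => (OSQ.act σ (p Y)) i)
      ((EuclideanSpace.proj i : EuclideanSpace ℝ (Fin d) →L[ℝ] ℝ).comp
        (fderiv ℝ (fun Y => OSQ.act σ (p Y)) Y)) Y :=
    (EuclideanSpace.proj i : EuclideanSpace ℝ (Fin d) →L[ℝ] ℝ).hasFDerivAt.comp Y
      (hg Y).hasFDerivAt
  have h2 : HasFDerivAt (fun Y => (OSQ.act σ (p Y)) i)
      (deriv σ (p Y i) • ((EuclideanSpace.proj i : EuclideanSpace ℝ (Fin d) →L[ℝ] ℝ).comp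
        (fderiv ℝ p Y))) Y :=
    ((hσ.differentiable (by norm_num)) (p Y i)).hasDerivAt.comp_hasFDerivAt Y (hpi i)
  have := congrArg (fun T => T b) (h1.unique h2)
  simpa using this

lemma act_contDiff {σ : ℝ → ℝ} (hσ : ContDiff ℝ 2 σ)
    {p : E → EuclideanSpace ℝ (Fin d)} (hp : ContDiff ℝ 2 p) :
    ContDiff ℝ 2 (fun Y => OSQ.act σ (p Y)) := by
  rw [contDiff_euclidean]
  intro i
  exact hσ.comp (contDiff_euclidean.1 hp i)

lemma dirDeriv_contDiff {F : Type*} [NormedAddCommGroup F] [NormedSpace ℝ F]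
    {p : E → F} (hp : ContDiff ℝ 2 p) (b : E) :
    ContDiff ℝ 1 (fun Y => fderiv ℝ p Y b) :=
  (hp.fderiv_right (m := 1) (by norm_num)).clm_apply contDiff_const

lemma act_second {σ : ℝ → ℝ} (hσ : ContDiff ℝ 2 σ)
    {p : E → EuclideanSpace ℝ (Fin d)} (hp : ContDiff ℝ 2 p) (a b X : E) :
    fderiv ℝ (fun Y => fderiv ℝ (fun Y => OSQ.act σ (p Y)) Y b) X a
      = WithLp.toLp 2 (fun i => deriv (deriv σ) (p X i) * (fderiv ℝ p X a) i * (fderiv ℝ p X b) i)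
        + WithLp.toLp 2 (fun i => deriv σ (p X i) *
          (fderiv ℝ (fun Y => fderiv ℝ p Y b) X a) i) := by
  have hpd : HasFDerivAt p (fderiv ℝ p X) X := (hp.differentiable (by norm_num) X).hasFDerivAt
  have hpi : ∀ i, HasFDerivAt (fun Y => p Y i)
      ((EuclideanSpace.proj i : EuclideanSpace ℝ (Fin d) →L[ℝ] ℝ).comp (fderiv ℝ p X)) X :=
    fun i => (EuclideanSpace.proj i : EuclideanSpace ℝ (Fin d) →L[ℝ] ℝ).hasFDerivAt.comp X hpd
  have hqd := ((dirDeriv_contDiff hp b).differentiable (by norm_num) X).hasFDerivAt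
  have hqi : ∀ i, HasFDerivAt (fun Y => (fderiv ℝ p Y b) i)
      ((EuclideanSpace.proj i : EuclideanSpace ℝ (Fin d) →L[ℝ] ℝ).comp
        (fderiv ℝ (fun Y => fderiv ℝ p Y b) X)) X :=
    fun i => (EuclideanSpace.proj i : EuclideanSpace ℝ (Fin d) →L[ℝ] ℝ).hasFDerivAt.comp X hqd
  have hσ1 : ContDiff ℝ 1 (deriv σ) := by
    have : ContDiff ℝ (1 + 1) σ := by simpa [one_add_one_eq_two] using hσ
    exact (contDiff_succ_iff_deriv.1 this).2.2
  have hg := ((dirDeriv_contDiff (act_contDiff hσ hp) b).differentiable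
    (by norm_num) X).hasFDerivAt
  ext i
  have h1 : HasFDerivAt (fun Y => (fderiv ℝ (fun Y => OSQ.act σ (p Y)) Y b) i)
      ((EuclideanSpace.proj i : EuclideanSpace ℝ (Fin d) →L[ℝ] ℝ).comp
        (fderiv ℝ (fun Y => fderiv ℝ (fun Y => OSQ.act σ (p Y)) Y b) X)) X :=
    (EuclideanSpace.proj i : EuclideanSpace ℝ (Fin d) →L[ℝ] ℝ).hasFDerivAt.comp X hg
  have he : (fun Y => (fderiv ℝ (fun Y => OSQ.act σ (p Y)) Y b) i)
      = fun Y => deriv σ (p Y i) * (fderiv ℝ p Y b) i := by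
    funext Y
    rw [act_hasFDerivAt hσ hp]
  have h2 := (((hσ1.differentiable (by norm_num)) (p X i)).hasDerivAt.comp_hasFDerivAt X
    (hpi i)).mul (hqi i)
  rw [he] at h1
  have := congrArg (fun T => T a) (h1.unique h2)
  simp at this
  simp [this]
  ring

lemma norm_mul_le_of_abs (s : Fin d → ℝ) (hs : ∀ i, |s i| ≤ 1) (x : EuclideanSpace ℝ (Fin d)) :
    ‖(WithLp.toLp 2 (fun i => s i * x i) : EuclideanSpace ℝ (Fin d))‖ ≤ ‖x‖ := by
  rw [EuclideanSpace.norm_eq, EuclideanSpace.norm_eq]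
  apply Real.sqrt_le_sqrt
  apply Finset.sum_le_sum
  intro i _
  have := hs i
  simp only [Real.norm_eq_abs, abs_mul]
  gcongr
  exact mul_le_of_le_one_left (abs_nonneg _) this

lemma norm_had_le (s : Fin d → ℝ) (hs : ∀ i, |s i| ≤ 1) (x y : EuclideanSpace ℝ (Fin d)) :
    ‖(WithLp.toLp 2 (fun i => s i * x i * y i) : EuclideanSpace ℝ (Fin d))‖ ≤ ‖x‖ * ‖y‖ := by
  rw [EuclideanSpace.norm_eq, EuclideanSpace.norm_eq y, ← Real.sqrt_sq (norm_nonneg x),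
    ← Real.sqrt_mul (sq_nonneg _)]
  apply Real.sqrt_le_sqrt
  rw [Finset.mul_sum]
  apply Finset.sum_le_sum
  intro i _
  have := hs i
  have hx : |x i| ≤ ‖x‖ := by simpa using PiLp.norm_apply_le x i
  simp only [Real.norm_eq_abs, abs_mul]
  rw [mul_pow, mul_pow]
  gcongr
  calc |s i| ^ 2 * |x i| ^ 2 ≤ 1 * ‖x‖ ^ 2 := by
        gcongr
        exact pow_le_one₀ (abs_nonneg _) this
    _ = _ := one_mul _

lemma clm_first {F F' : Type*} [NormedAddCommGroup F] [NormedSpace ℝ F]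
    [NormedAddCommGroup F'] [NormedSpace ℝ F'] (L : F →L[ℝ] F')
    {f : E → F} (hf : ContDiff ℝ 2 f) (b X : E) :
    fderiv ℝ (fun Y => L (f Y)) X b = L (fderiv ℝ f X b) := by
  have := (L.hasFDerivAt.comp X (hf.differentiable (by norm_num) X).hasFDerivAt).fderiv
  change fderiv ℝ (L ∘ f) X b = _
  rw [this]; rfl

lemma clm_second {F F' : Type*} [NormedAddCommGroup F] [NormedSpace ℝ F]
    [NormedAddCommGroup F'] [NormedSpace ℝ F'] (L : F →L[ℝ] F')
    {f : E → F} (hf : ContDiff ℝ 2 f) (a b X : E) :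
    fderiv ℝ (fun Y => fderiv ℝ (fun Y => L (f Y)) Y b) X a
      = L (fderiv ℝ (fun Y => fderiv ℝ f Y b) X a) := by
  have : (fun Y => fderiv ℝ (fun Y => L (f Y)) Y b) = L ∘ (fun Y => fderiv ℝ f Y b) := by
    funext Y; exact clm_first L hf b Y
  rw [this, (L.hasFDerivAt.comp X
    ((dirDeriv_contDiff hf b).differentiable (by norm_num) X).hasFDerivAt).fderiv]
  rfl

/-- abstract propagation bounds for a network `h (t+1) i = act σ (L t i (h t))`. -/
lemma prop_bounds {σ : ℝ → ℝ} (hσ : ContDiff ℝ 2 σ)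
    (hσ' : ∀ x, |deriv σ x| ≤ 1) (hσ'' : ∀ x, |deriv (deriv σ) x| ≤ 1)
    (h : ℕ → (Fin n → EuclideanSpace ℝ (Fin d)) → Fin n → EuclideanSpace ℝ (Fin d))
    (L : ℕ → Fin n → (Fin n → EuclideanSpace ℝ (Fin d)) →L[ℝ] EuclideanSpace ℝ (Fin d))
    (Z : Matrix (Fin n) (Fin n) ℝ) (hZ : ∀ i j, 0 ≤ Z i j)
    (hL : ∀ t i x, ‖L t i x‖ ≤ ∑ j, Z i j * ‖x j‖)
    (h0 : ∀ X, h 0 X = X) (hs : ∀ t X i, h (t+1) X i = OSQ.act σ (L t i (h t X)))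
    (v u : Fin n) (α β : Fin d) (X : Fin n → EuclideanSpace ℝ (Fin d))
    (r : Fin n → ℝ) (hr : ∀ i, 0 ≤ r i) (hrZ : ∀ j, ∑ i, r i * Z i j = r j) (t : ℕ) :
    ContDiff ℝ 2 (h t) ∧
    (∀ i v α, ‖fderiv ℝ (h t) X (OSQ.dir v α) i‖ ≤ (Z ^ t) i v) ∧
    ∑ i, r i * ‖fderiv ℝ (fun Y => fderiv ℝ (h t) Y (OSQ.dir u β)) X (OSQ.dir v α) i‖ ≤
      ∑ k ∈ Finset.range t, ∑ i, r i * ((Z ^ (k+1)) i v * (Z ^ (k+1)) i u) := by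
  induction t with
  | zero =>
    have e : h 0 = id := funext h0
    refine ⟨e ▸ contDiff_id, ?_, ?_⟩
    · intro i v α
      rw [e, fderiv_id]
      simp only [ContinuousLinearMap.id_apply, OSQ.dir, pow_zero, Matrix.one_apply, Pi.single_apply]
      split_ifs <;> simp
    · rw [e]
      simp
  | succ t ih =>
    obtain ⟨hC, hJ, hH⟩ := ih
    have hpC : ∀ i, ContDiff ℝ 2 (fun Y => L t i (h t Y)) := fun i => (L t i).contDiff.comp hC
    have hCi : ∀ i, ContDiff ℝ 2 (fun Y => h (t+1) Y i) := by
      intro i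
      simp only [hs]
      exact act_contDiff hσ (hpC i)
    have hC' : ContDiff ℝ 2 (h (t+1)) := contDiff_pi.2 hCi
    have key1 : ∀ b Y i, fderiv ℝ (h (t+1)) Y b i
        = fderiv ℝ (fun Y => OSQ.act σ (L t i (h t Y))) Y b := by
      intro b Y i
      have := clm_first (ContinuousLinearMap.proj (R := ℝ) (φ := fun _ : Fin n => EuclideanSpace ℝ (Fin d)) i) hC' b Y
      simp only [ContinuousLinearMap.proj_apply, hs] at this
      exact this.symm
    have key2 : ∀ a b Y i, fderiv ℝ (fun Y => fderiv ℝ (h (t+1)) Y b) Y a i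
        = fderiv ℝ (fun Y => fderiv ℝ (fun Y => OSQ.act σ (L t i (h t Y))) Y b) Y a := by
      intro a b Y i
      have := clm_second (ContinuousLinearMap.proj (R := ℝ) (φ := fun _ : Fin n => EuclideanSpace ℝ (Fin d)) i) hC' a b Y
      simp only [ContinuousLinearMap.proj_apply, hs] at this
      exact this.symm
    have hp1 : ∀ i v α, ‖fderiv ℝ (fun Y => L t i (h t Y)) X (OSQ.dir v α)‖ ≤ (Z ^ (t+1)) i v := by
      intro i v α
      rw [clm_first (L t i) hC]
      refine (hL _ _ _).trans ?_
      rw [pow_succ', Matrix.mul_apply]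
      exact Finset.sum_le_sum fun j _ => mul_le_mul_of_nonneg_left (hJ j v α) (hZ i j)
    refine ⟨hC', ?_, ?_⟩
    · intro i v α
      rw [key1, act_hasFDerivAt hσ (hpC i)]
      exact (norm_mul_le_of_abs _ (fun i => hσ' _) _).trans (hp1 i v α)
    · have step : ∀ i, ‖fderiv ℝ (fun Y => fderiv ℝ (h (t+1)) Y (OSQ.dir u β)) X (OSQ.dir v α) i‖
          ≤ (Z ^ (t+1)) i v * (Z ^ (t+1)) i u + ∑ j, Z i j *
            ‖fderiv ℝ (fun Y => fderiv ℝ (h t) Y (OSQ.dir u β)) X (OSQ.dir v α) j‖ := by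
        intro i
        rw [key2, act_second hσ (hpC i)]
        refine (norm_add_le _ _).trans (add_le_add ?_ ?_)
        · refine (norm_had_le _ (fun i => hσ'' _) _ _).trans ?_
          exact mul_le_mul (hp1 i v α) (hp1 i u β) (norm_nonneg _)
            ((norm_nonneg _).trans (hp1 i v α))
        · refine (norm_mul_le_of_abs _ (fun i => hσ' _) _).trans ?_
          rw [clm_second (L t i) hC]
          exact hL _ _ _
      refine (Finset.sum_le_sum fun i _ => mul_le_mul_of_nonneg_left (step i) (hr i)).trans ?_
      rw [Finset.sum_range_succ]
      simp only [mul_add, Finset.sum_add_distrib]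
      rw [add_comm]
      refine add_le_add ?_ le_rfl
      refine le_trans (le_of_eq ?_) hH
      simp only [Finset.mul_sum]
      rw [Finset.sum_comm]
      refine Finset.sum_congr rfl fun j _ => ?_
      conv_rhs => rw [← hrZ j, Finset.sum_mul]
      exact Finset.sum_congr rfl fun i _ => by ring

end helpers

section spectral


def cj (U : Matrix (Fin n) (Fin n) ℝ) (f : Fin n → ℝ) : Matrix (Fin n) (Fin n) ℝ :=
  U.transpose * Matrix.diagonal f * U

lemma cj_mul {U : Matrix (Fin n) (Fin n) ℝ} (hU : U * U.transpose = 1) (f g : Fin n → ℝ) :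
    cj U f * cj U g = cj U (f * g) := by
  unfold cj
  calc U.transpose * Matrix.diagonal f * U * (U.transpose * Matrix.diagonal g * U)
      = U.transpose * Matrix.diagonal f * (U * U.transpose) * Matrix.diagonal g * U := by
        simp only [Matrix.mul_assoc]
    _ = _ := by
        rw [hU, Matrix.mul_one, Matrix.mul_assoc U.transpose, Matrix.diagonal_mul_diagonal]; rfl

lemma cj_one {U : Matrix (Fin n) (Fin n) ℝ} (hU : U * U.transpose = 1) :
    cj U 1 = 1 := by
  unfold cj
  rw [show Matrix.diagonal (1 : Fin n → ℝ) = 1 from Matrix.diagonal_one, Matrix.mul_one]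
  exact mul_eq_one_comm.1 hU

lemma cj_add (U : Matrix (Fin n) (Fin n) ℝ) (f g : Fin n → ℝ) :
    cj U f + cj U g = cj U (f + g) := by
  unfold cj
  rw [← Matrix.add_mul, ← Matrix.mul_add, Matrix.diagonal_add]; rfl

lemma cj_smul (U : Matrix (Fin n) (Fin n) ℝ) (c : ℝ) (f : Fin n → ℝ) :
    c • cj U f = cj U (c • f) := by
  unfold cj
  rw [Matrix.diagonal_smul, Matrix.mul_smul, Matrix.smul_mul]

lemma cj_sub (U : Matrix (Fin n) (Fin n) ℝ) (f g : Fin n → ℝ) :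
    cj U f - cj U g = cj U (f - g) := by
  unfold cj
  rw [← Matrix.sub_mul, ← Matrix.mul_sub, Matrix.diagonal_sub]; rfl

lemma cj_pow {U : Matrix (Fin n) (Fin n) ℝ} (hU : U * U.transpose = 1) (f : Fin n → ℝ) (k : ℕ) :
    cj U f ^ k = cj U (f ^ k) := by
  induction k with
  | zero => rw [pow_zero, pow_zero, cj_one hU]
  | succ k ih => rw [pow_succ, ih, cj_mul hU, pow_succ]

lemma cj_sum (U : Matrix (Fin n) (Fin n) ℝ) (f : ℕ → Fin n → ℝ) (k : ℕ) :
    ∑ i ∈ Finset.range k, cj U (f i) = cj U (∑ i ∈ Finset.range k, f i) := by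
  induction k with
  | zero => simp [cj]
  | succ k ih => rw [Finset.sum_range_succ, ih, cj_add, Finset.sum_range_succ]

lemma cj_apply (U : Matrix (Fin n) (Fin n) ℝ) (f : Fin n → ℝ) (a b : Fin n) :
    cj U f a b = ∑ l, f l * (U l a * U l b) := by
  unfold cj
  rw [Matrix.mul_apply]
  simp only [Matrix.mul_diagonal, Matrix.transpose_apply]
  exact Finset.sum_congr rfl fun l _ => by ring

lemma spectral_id (hn : 0 < n) (Δ : Matrix (Fin n) (Fin n) ℝ) (c₂ : ℝ) (hc₂ : 0 < c₂)
    (hc1 : c₂ ≤ 1)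
    (lam : Fin n → ℝ) (φ : Fin n → Fin n → ℝ)
    (horth : ∀ k l, ∑ a, φ k a * φ l a = if k = l then (1 : ℝ) else 0)
    (heig : ∀ ℓ, Δ.mulVec (φ ℓ) = lam ℓ • φ ℓ)
    (hlam0 : lam ⟨0, hn⟩ = 0)
    (hlampos : ∀ ℓ : Fin n, (ℓ : ℕ) ≠ 0 → 0 < lam ℓ)
    (hlamlt : ∀ ℓ, lam ℓ < 2) (Z : Matrix (Fin n) (Fin n) ℝ) (hZ : Z = 1 - c₂ • Δ)
    (m : ℕ) (v u : Fin n) :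
    (m : ℝ) * (φ ⟨0, hn⟩ v * φ ⟨0, hn⟩ u) +
      (1 / c₂) * ((Z ^ 2 * (1 - Z ^ (2 * m)) * (1 + Z)⁻¹ * OSQ.nLapPinv lam φ : Matrix (Fin n) (Fin n) ℝ) v u)
      = ∑ k ∈ Finset.range m, (Z ^ (2 * (k + 1))) v u := by
  set U : Matrix (Fin n) (Fin n) ℝ := Matrix.of φ with hUdef
  have hU : U * U.transpose = 1 := by
    ext k l
    simp only [Matrix.mul_apply, Matrix.transpose_apply, hUdef, Matrix.of_apply, Matrix.one_apply]
    exact horth k l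
  have hU' : U.transpose * U = 1 := mul_eq_one_comm.1 hU
  have hΔ : Δ = cj U lam := by
    have h1 : Δ * U.transpose = U.transpose * Matrix.diagonal lam := by
      ext a l
      have := congrFun (heig l) a
      rw [Matrix.mul_diagonal]
      simp only [Matrix.mulVec, dotProduct, Pi.smul_apply, smul_eq_mul] at this
      simp only [Matrix.mul_apply, Matrix.transpose_apply, hUdef, Matrix.of_apply]
      rw [this]; ring
    unfold cj
    rw [← h1, Matrix.mul_assoc, hU', Matrix.mul_one]
  have hZc : Z = cj U (1 - c₂ • lam) := by
    rw [hZ, hΔ, cj_smul, ← cj_sub, cj_one hU]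
  set z : Fin n → ℝ := 1 - c₂ • lam with hz
  have hlam_nn : ∀ l, 0 ≤ lam l := by
    intro l
    by_cases h : (l : ℕ) = 0
    · have : l = ⟨0, hn⟩ := Fin.ext h
      rw [this, hlam0]
    · exact (hlampos l h).le
  have hz1 : ∀ l, 0 < 1 + z l := by
    intro l
    simp only [hz, Pi.sub_apply, Pi.one_apply, Pi.smul_apply, smul_eq_mul]
    nlinarith [hlamlt l, hlam_nn l]
  have hinv : (1 + Z)⁻¹ = cj U (fun l => 1 / (1 + z l)) := by
    apply Matrix.inv_eq_right_inv
    rw [hZc, ← cj_one hU, cj_add, cj_mul hU]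
    congr 1
    funext l
    have := (hz1 l).ne'
    simp only [Pi.mul_apply, Pi.add_apply, Pi.one_apply]
    field_simp
  have hP : OSQ.nLapPinv lam φ = cj U (fun l => if (l : ℕ) ≠ 0 then 1 / lam l else 0) := by
    ext a b
    rw [cj_apply]
    simp only [OSQ.nLapPinv, Matrix.of_apply, Finset.sum_filter, hUdef]
    refine Finset.sum_congr rfl fun l _ => ?_
    split_ifs <;> simp
  have h0 : (m : ℝ) * (φ ⟨0, hn⟩ v * φ ⟨0, hn⟩ u)
      = cj U (fun l => if (l : ℕ) = 0 then (m : ℝ) else 0) v u := by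
    rw [cj_apply, Finset.sum_eq_single ⟨0, hn⟩]
    · simp [hUdef]
    · intro b _ hb
      have : (b : ℕ) ≠ 0 := fun h => hb (Fin.ext h)
      simp [this]
    · simp
  have hR : ∑ k ∈ Finset.range m, (Z ^ (2 * (k + 1))) v u
      = cj U (∑ k ∈ Finset.range m, z ^ (2 * (k+1))) v u := by
    rw [← cj_sum, Matrix.sum_apply]
    simp only [hZc, cj_pow hU]
  rw [h0, hR, hinv, hP, hZc, ← cj_one hU, cj_pow hU, cj_pow hU, cj_sub, cj_mul hU, cj_mul hU,
    cj_mul hU, ← smul_eq_mul (1 / c₂), ← Matrix.smul_apply, cj_smul, ← Matrix.add_apply, cj_add]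
  congr 1
  congr 1
  funext l
  simp only [Pi.add_apply, Pi.smul_apply, Pi.mul_apply, Pi.sub_apply, Pi.one_apply, Pi.pow_apply,
    smul_eq_mul, Finset.sum_apply]
  by_cases h : (l : ℕ) = 0
  · have hl : l = ⟨0, hn⟩ := Fin.ext h
    have : z l = 1 := by simp [hz, hl, hlam0]
    simp [h, this]
  · have hzl : z l = 1 - c₂ * lam l := by simp [hz]
    have hl := hlampos l h
    have h1 := hz1 l
    have hg : ∀ m : ℕ, (∑ k ∈ Finset.range m, z l ^ (2 * (k+1))) * (1 - z l ^ 2)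
        = z l ^ 2 * (1 - z l ^ (2 * m)) := by
      intro m
      induction m with
      | zero => simp
      | succ m ih => rw [Finset.sum_range_succ, add_mul, ih]; ring
    have hlz : c₂ * lam l = 1 - z l := by rw [hzl]; ring
    simp only [h, if_false, ne_eq, not_false_eq_true, if_true, zero_add]
    rw [← hg m]
    have e : (1 - z l ^ 2) = (c₂ * lam l) * (1 + z l) := by rw [hlz]; ring
    rw [e]
    field_simp

end spectral

section graph

lemma Asym_apply (G : SimpleGraph (Fin n)) [DecidableRel G.Adj] (i j : Fin n) :
    Asym G i j = (Real.sqrt (G.degree i))⁻¹ * (G.adjMatrix ℝ i j) * (Real.sqrt (G.degree j))⁻¹ := by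
  unfold Asym
  rw [Matrix.mul_diagonal, Matrix.diagonal_mul]

lemma Asym_nonneg (G : SimpleGraph (Fin n)) [DecidableRel G.Adj] (i j : Fin n) :
    0 ≤ Asym G i j := by
  rw [Asym_apply, SimpleGraph.adjMatrix_apply]
  split_ifs <;> positivity

lemma Asym_symm (G : SimpleGraph (Fin n)) [DecidableRel G.Adj] (i j : Fin n) :
    Asym G i j = Asym G j i := by
  rw [Asym_apply, Asym_apply, SimpleGraph.adjMatrix_apply, SimpleGraph.adjMatrix_apply]
  simp only [G.adj_comm i j]
  ring

lemma sum_adj (G : SimpleGraph (Fin n)) [DecidableRel G.Adj] (i : Fin n) :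
    ∑ j, G.adjMatrix ℝ i j = G.degree i := by
  have := G.adjMatrix_mulVec_const_apply (α := ℝ) (a := 1) (v := i)
  simpa [Matrix.mulVec, dotProduct] using this

lemma Asym_sqrt (G : SimpleGraph (Fin n)) [DecidableRel G.Adj] (hd : ∀ i, 0 < G.degree i)
    (i : Fin n) : ∑ j, Asym G i j * Real.sqrt (G.degree j) = Real.sqrt (G.degree i) := by
  have hs : ∀ j, Real.sqrt (G.degree j) ≠ 0 := fun j =>
    (Real.sqrt_pos.2 (by exact_mod_cast hd j)).ne'
  have : ∀ j, Asym G i j * Real.sqrt (G.degree j)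
      = (Real.sqrt (G.degree i))⁻¹ * G.adjMatrix ℝ i j := by
    intro j
    rw [Asym_apply, mul_assoc, inv_mul_cancel₀ (hs j), mul_one]
  simp only [this]
  rw [← Finset.mul_sum, sum_adj, inv_mul_eq_div, Real.div_sqrt]

lemma sqrt_ratio (G : SimpleGraph (Fin n)) [DecidableRel G.Adj] (hd : ∀ i, 0 < G.degree i)
    (i j : Fin n) : Real.sqrt (G.degree i) ≤
      Real.sqrt ((G.maxDegree : ℝ) / (G.minDegree : ℝ)) * Real.sqrt (G.degree j) := by
  haveI : Nonempty (Fin n) := ⟨i⟩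
  obtain ⟨k, hk⟩ := G.exists_minimal_degree_vertex
  have hm : (0 : ℝ) < G.minDegree := by rw [hk]; exact_mod_cast hd k
  rw [← Real.sqrt_mul (by positivity)]
  apply Real.sqrt_le_sqrt
  have h1 : (G.degree i : ℝ) ≤ G.maxDegree := by exact_mod_cast G.degree_le_maxDegree i
  have h2 : (G.minDegree : ℝ) ≤ G.degree j := by exact_mod_cast G.minDegree_le_degree j
  rw [div_mul_eq_mul_div, le_div_iff₀ hm]
  exact mul_le_mul h1 h2 hm.le (by positivity)

lemma Asym_rowsum (G : SimpleGraph (Fin n)) [DecidableRel G.Adj] (hd : ∀ i, 0 < G.degree i)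
    (i : Fin n) : ∑ j, Asym G i j ≤ Real.sqrt ((G.maxDegree : ℝ) / (G.minDegree : ℝ)) := by
  have hs : 0 < Real.sqrt (G.degree i) := Real.sqrt_pos.2 (by exact_mod_cast hd i)
  rw [← mul_le_mul_iff_left₀ hs, Finset.sum_mul]
  calc ∑ j, Asym G i j * Real.sqrt (G.degree i)
      ≤ ∑ j, Asym G i j * (Real.sqrt ((G.maxDegree : ℝ) / (G.minDegree : ℝ))
          * Real.sqrt (G.degree j)) :=
        Finset.sum_le_sum fun j _ =>
          mul_le_mul_of_nonneg_left (sqrt_ratio G hd i j) (Asym_nonneg G i j)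
    _ = Real.sqrt ((G.maxDegree : ℝ) / (G.minDegree : ℝ)) *
          ∑ j, Asym G i j * Real.sqrt (G.degree j) := by
        rw [Finset.mul_sum]
        exact Finset.sum_congr rfl fun j _ => by ring
    _ = _ := by rw [Asym_sqrt G hd]

lemma Zmat_eq (c₂ : ℝ) (G : SimpleGraph (Fin n)) [DecidableRel G.Adj] :
    Zmat c₂ G = (1 - c₂) • (1 : Matrix (Fin n) (Fin n) ℝ) + c₂ • Asym G := by
  unfold Zmat nLap
  module

lemma Zmat_apply (c₂ : ℝ) (G : SimpleGraph (Fin n)) [DecidableRel G.Adj] (i j : Fin n) :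
    Zmat c₂ G i j = (1 - c₂) * (if i = j then 1 else 0) + c₂ * Asym G i j := by
  rw [Zmat_eq]
  simp [Matrix.one_apply]

lemma Zmat_sum (c₂ : ℝ) (G : SimpleGraph (Fin n)) [DecidableRel G.Adj] (i : Fin n)
    (x : Fin n → ℝ) :
    ∑ j, Zmat c₂ G i j * x j = (1 - c₂) * x i + c₂ * ∑ j, Asym G i j * x j := by
  simp only [Zmat_apply, add_mul, Finset.sum_add_distrib, Finset.mul_sum]
  congr 1
  · simp
  · exact Finset.sum_congr rfl fun j _ => by ring

/-- one pre-activation layer as a continuous linear map, with its bound. -/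
lemma layer_clm (G : SimpleGraph (Fin n)) [DecidableRel G.Adj] (hd : ∀ i, 0 < G.degree i)
    (Ω W : EuclideanSpace ℝ (Fin d) →L[ℝ] EuclideanSpace ℝ (Fin d))
    (ω w : ℝ) (hw : 0 < w) (hΩ : ‖Ω‖ ≤ ω) (hW : ‖W‖ ≤ w)
    (ψ : EuclideanSpace ℝ (Fin d) × EuclideanSpace ℝ (Fin d) → EuclideanSpace ℝ (Fin d))
    (hψlin : IsLinearMap ℝ ψ) (c₁ c₂ : ℝ)
    (hψ₁ : ∀ x y, ‖fderiv ℝ (fun z => ψ (z, y)) x‖ ≤ c₁)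
    (hψ₂ : ∀ x y, ‖fderiv ℝ (fun z => ψ (x, z)) y‖ ≤ c₂)
    (hw1 : w ≤ 1)
    (hcap : ω / w + c₁ * Real.sqrt ((G.maxDegree : ℝ) / (G.minDegree : ℝ)) + c₂ ≤ 1)
    (i : Fin n) :
    ∃ L : (Fin n → EuclideanSpace ℝ (Fin d)) →L[ℝ] EuclideanSpace ℝ (Fin d),
      (∀ x, L x = Ω (x i) + W (∑ u : Fin n, Asym G i u • ψ (x i, x u))) ∧
      ∀ x, ‖L x‖ ≤ ∑ j, Zmat c₂ G i j * ‖x j‖ := by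
  set Ψ : EuclideanSpace ℝ (Fin d) × EuclideanSpace ℝ (Fin d) →L[ℝ] EuclideanSpace ℝ (Fin d) :=
    LinearMap.toContinuousLinearMap (hψlin.mk' ψ) with hΨ
  have hΨa : ∀ p, ψ p = Ψ p := fun p => rfl
  set P := Ψ.comp (ContinuousLinearMap.inl ℝ _ _) with hP
  set Q := Ψ.comp (ContinuousLinearMap.inr ℝ _ _) with hQ
  have hψe : ∀ x y, ψ (x, y) = P x + Q y := by
    intro x y
    rw [hΨa, hP, hQ]
    simp only [ContinuousLinearMap.comp_apply, ContinuousLinearMap.inl_apply,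
      ContinuousLinearMap.inr_apply]
    rw [← map_add]; simp
  have hPn : ‖P‖ ≤ c₁ := by
    have := hψ₁ 0 0
    simp only [hψe] at this
    rw [fderiv_add_const] at this
    rwa [ContinuousLinearMap.fderiv] at this
  have hQn : ‖Q‖ ≤ c₂ := by
    have := hψ₂ 0 0
    simp only [hψe] at this
    rw [fderiv_const_add] at this
    rwa [ContinuousLinearMap.fderiv] at this
  have hc1 : 0 ≤ c₁ := (norm_nonneg _).trans hPn
  have hc2 : 0 ≤ c₂ := (norm_nonneg _).trans hQn
  let pr : Fin n → (Fin n → EuclideanSpace ℝ (Fin d)) →L[ℝ] EuclideanSpace ℝ (Fin d) :=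
    fun j => ContinuousLinearMap.proj j
  have hpr : ∀ j x, pr j x = x j := fun j x => rfl
  refine ⟨Ω.comp (pr i) + W.comp (∑ u : Fin n, Asym G i u • (P.comp (pr i) + Q.comp (pr u))),
    ?_, ?_⟩
  · intro x
    simp [hψe, hpr, ContinuousLinearMap.sum_apply]
  · intro x
    simp only [ContinuousLinearMap.add_apply, ContinuousLinearMap.comp_apply,
      ContinuousLinearMap.sum_apply, ContinuousLinearMap.smul_apply, hpr]
    rw [Zmat_sum]
    set g := Real.sqrt ((G.maxDegree : ℝ) / (G.minDegree : ℝ)) with hg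
    set s := ∑ j, Asym G i j * ‖x j‖ with hs
    have hs0 : 0 ≤ s := Finset.sum_nonneg fun j _ => mul_nonneg (Asym_nonneg G i j) (norm_nonneg _)
    have hin : ‖∑ j, Asym G i j • (P (x i) + Q (x j))‖ ≤ g * (c₁ * ‖x i‖) + c₂ * s := by
      calc _ ≤ ∑ j, (Asym G i j * (c₁ * ‖x i‖) + c₂ * (Asym G i j * ‖x j‖)) := by
            refine norm_sum_le_of_le _ fun j _ => ?_
            rw [norm_smul, Real.norm_of_nonneg (Asym_nonneg G i j)]
            have : ‖P (x i) + Q (x j)‖ ≤ c₁ * ‖x i‖ + c₂ * ‖x j‖ :=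
              (norm_add_le _ _).trans (add_le_add (P.le_of_opNorm_le hPn _)
                (Q.le_of_opNorm_le hQn _))
            calc _ ≤ Asym G i j * (c₁ * ‖x i‖ + c₂ * ‖x j‖) :=
                  mul_le_mul_of_nonneg_left this (Asym_nonneg G i j)
              _ = _ := by ring
        _ = (∑ j, Asym G i j) * (c₁ * ‖x i‖) + c₂ * s := by
            rw [Finset.sum_add_distrib, Finset.sum_mul, hs, Finset.mul_sum]
        _ ≤ _ := by
            gcongr
            exact Asym_rowsum G hd i
    calc _ ≤ ω * ‖x i‖ + w * (g * (c₁ * ‖x i‖) + c₂ * s) := by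
          refine (norm_add_le _ _).trans (add_le_add (Ω.le_of_opNorm_le hΩ _) ?_)
          refine (W.le_of_opNorm_le hW _).trans ?_
          gcongr
      _ = w * ((ω / w + c₁ * g) * ‖x i‖ + c₂ * s) := by field_simp; ring
      _ ≤ w * ((1 - c₂) * ‖x i‖ + c₂ * s) := by
          gcongr
          linarith
      _ ≤ _ := by
          have h0 : 0 ≤ ω := (norm_nonneg _).trans hΩ
          have : 0 ≤ ω / w + c₁ * g := by positivity
          have h1 : 0 ≤ 1 - c₂ := by linarith
          exact mul_le_of_le_one_left (by positivity) hw1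

end graph

/-- pseudo-inverse mixing bound for `𝒜 = A_sym` with linear message
functions (`c⁽²⁾ = 0`). -/
theorem mixing_bound_pseudoinverse_linear (hn : 0 < n)
    (G : SimpleGraph (Fin n)) [DecidableRel G.Adj] (hconn : G.Connected)
    (σ : ℝ → ℝ) (hσ : ContDiff ℝ 2 σ)
    (hσ' : ∀ x, |deriv σ x| ≤ 1) (hσ'' : ∀ x, |deriv (deriv σ) x| ≤ 1)
    (Ω W : ℕ → EuclideanSpace ℝ (Fin d) →L[ℝ] EuclideanSpace ℝ (Fin d))
    (ω w : ℝ) (hw : 0 < w) (hΩ : ∀ t, ‖Ω t‖ ≤ ω) (hW : ∀ t, ‖W t‖ ≤ w)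
    (ψ : ℕ → EuclideanSpace ℝ (Fin d) × EuclideanSpace ℝ (Fin d) → EuclideanSpace ℝ (Fin d))
    (hψlin : ∀ t, IsLinearMap ℝ (ψ t)) (c₁ c₂ : ℝ) (hc₂ : 0 < c₂)
    (hψ₁ : ∀ t x y, ‖fderiv ℝ (fun z => ψ t (z, y)) x‖ ≤ c₁)
    (hψ₂ : ∀ t x y, ‖fderiv ℝ (fun z => ψ t (x, z)) y‖ ≤ c₂)
    (γ : ℝ) (hγ : γ = Real.sqrt ((G.maxDegree : ℝ) / (G.minDegree : ℝ)))
    (hw1 : w ≤ 1) (hcap : ω / w + c₁ * γ + c₂ ≤ 1)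
    (lam : Fin n → ℝ) (φ : Fin n → Fin n → ℝ)
    (horth : ∀ k l, ∑ a, φ k a * φ l a = if k = l then (1 : ℝ) else 0)
    (heig : ∀ ℓ, (nLap G).mulVec (φ ℓ) = lam ℓ • φ ℓ)
    (hmono : Monotone lam)
    (hlam0 : lam ⟨0, hn⟩ = 0)
    (hlampos : ∀ ℓ : Fin n, (ℓ : ℕ) ≠ 0 → 0 < lam ℓ)
    (hlamlt : ∀ ℓ, lam ℓ < 2)
    (hφ0 : ∀ a, φ ⟨0, hn⟩ a = Real.sqrt ((G.degree a : ℝ) / (2 * G.edgeFinset.card)))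
    (θ : EuclideanSpace ℝ (Fin d)) (hθ : ‖θ‖ = 1)
    (m : ℕ) (v u : Fin n) (X : Fin n → EuclideanSpace ℝ (Fin d)) (α β : Fin d) :
    |OSQ.mixEntry θ σ (Asym G) Ω W ψ m v u X α β|
      ≤ γ * ((m : ℝ) * Real.sqrt ((G.degree v : ℝ) * (G.degree u : ℝ)) /
              (2 * (G.edgeFinset.card : ℝ))
            + (1 / c₂) * ((Zmat c₂ G ^ 2 * (1 - Zmat c₂ G ^ (2 * m)) *
                (1 + Zmat c₂ G)⁻¹ * nLapPinv lam φ
                  : Matrix (Fin n) (Fin n) ℝ) v u)) := by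
  have hc21 : c₂ ≤ 1 := by
    have h0 : 0 ≤ ω := (norm_nonneg _).trans (hΩ 0)
    have h1 : 0 ≤ c₁ := (norm_nonneg _).trans (hψ₁ 0 0 0)
    have h2 : 0 ≤ γ := hγ ▸ Real.sqrt_nonneg _
    have : 0 ≤ ω / w + c₁ * γ := by positivity
    linarith
  have hd : ∀ i, 0 < G.degree i := by
    by_cases h1 : n = 1
    · subst h1
      exfalso
      have hz : ∀ a : Fin 1, G.degree a = 0 := fun a => by
        have := G.degree_lt_card_verts a
        simpa using this
      have := horth ⟨0, hn⟩ ⟨0, hn⟩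
      simp only [hφ0, hz] at this
      simp at this
    · haveI : Nontrivial (Fin n) := Fin.nontrivial_iff_two_le.2 (by omega)
      exact fun i => hconn.preconnected.degree_pos_of_nontrivial i
  have hspec := spectral_id hn (nLap G) c₂ hc₂ hc21 lam φ horth heig hlam0 hlampos hlamlt
    (Zmat c₂ G) rfl m v u
  have hφφ : φ ⟨0, hn⟩ v * φ ⟨0, hn⟩ u
      = Real.sqrt ((G.degree v : ℝ) * (G.degree u : ℝ)) / (2 * (G.edgeFinset.card : ℝ)) := by
    rw [hφ0, hφ0, ← Real.sqrt_mul (by positivity), div_mul_div_comm,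
      Real.sqrt_div (by positivity), Real.sqrt_mul_self (by positivity)]
  rw [hφφ, ← mul_div_assoc] at hspec
  rw [hspec]
  subst hγ
  choose L hL1 hL2 using fun t => layer_clm G hd (Ω (t+1)) (W (t+1)) ω w hw (hΩ _) (hW _)
    (ψ (t+1)) (hψlin _) c₁ c₂ (hψ₁ _) (hψ₂ _) hw1 hcap
  have hZnn : ∀ i j, 0 ≤ Zmat c₂ G i j := by
    intro i j
    rw [Zmat_apply]
    have h1 : 0 ≤ 1 - c₂ := by linarith
    have h2 := Asym_nonneg G i j
    split_ifs <;> positivity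
  have hZsymm : (Zmat c₂ G).transpose = Zmat c₂ G := by
    ext i j
    rw [Matrix.transpose_apply, Zmat_apply, Zmat_apply, Asym_symm G j i]
    simp only [eq_comm]
  have hrZ : ∀ j, ∑ i, Real.sqrt (G.degree i) * Zmat c₂ G i j = Real.sqrt (G.degree j) := by
    intro j
    have h1 := Zmat_sum c₂ G j (fun i => Real.sqrt (G.degree i))
    rw [Asym_sqrt G hd] at h1
    rw [← hZsymm]
    simp only [Matrix.transpose_apply]
    rw [show Real.sqrt (G.degree j)
      = (1 - c₂) * Real.sqrt (G.degree j) + c₂ * Real.sqrt (G.degree j) by ring, ← h1]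
    exact Finset.sum_congr rfl fun i _ => mul_comm _ _
  have hpb := prop_bounds hσ hσ' hσ'' (mpnn σ (Asym G) Ω W ψ) L (Zmat c₂ G) hZnn hL2
    (fun X => rfl) (fun t X i => by rw [hL1]; rfl)
    v u α β X (fun i => Real.sqrt (G.degree i)) (fun i => Real.sqrt_nonneg _) hrZ m
  obtain ⟨hC, -, hH⟩ := hpb
  set Θ : (Fin n → EuclideanSpace ℝ (Fin d)) →L[ℝ] ℝ :=
    (innerSL ℝ θ).comp (∑ i : Fin n, ContinuousLinearMap.proj i) with hΘ
  have hΘa : ∀ x, Θ x = ∑ α : Fin d, θ α * (∑ v : Fin n, x v) α := by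
    intro x
    simp only [hΘ, ContinuousLinearMap.comp_apply, ContinuousLinearMap.sum_apply,
      ContinuousLinearMap.proj_apply, innerSL_apply_apply, PiLp.inner_apply]
    exact Finset.sum_congr rfl fun i _ => by simp [mul_comm]
  have hΘb : ∀ x, |Θ x| ≤ ∑ i, ‖x i‖ := by
    intro x
    simp only [hΘ, ContinuousLinearMap.comp_apply, ContinuousLinearMap.sum_apply,
      ContinuousLinearMap.proj_apply, innerSL_apply_apply]
    refine (abs_real_inner_le_norm _ _).trans ?_
    rw [hθ, one_mul]
    exact norm_sum_le _ _
  have hmix : mixEntry θ σ (Asym G) Ω W ψ m v u X α β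
      = Θ (fderiv ℝ (fun Y => fderiv ℝ (mpnn σ (Asym G) Ω W ψ m) Y (dir u β)) X (dir v α)) := by
    rw [← clm_second Θ hC]
    simp only [mixEntry, readout, hΘa]
  rw [hmix]
  refine (hΘb _).trans ?_
  set H := fderiv ℝ (fun Y => fderiv ℝ (mpnn σ (Asym G) Ω W ψ m) Y (dir u β)) X (dir v α)
  have hpow : ∀ k i j, 0 ≤ (Zmat c₂ G ^ k) i j := by
    intro k
    induction k with
    | zero => intro i j; rw [pow_zero, Matrix.one_apply]; split_ifs <;> norm_num
    | succ k ih =>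
      intro i j
      rw [pow_succ, Matrix.mul_apply]
      exact Finset.sum_nonneg fun l _ => mul_nonneg (ih i l) (hZnn l j)
  haveI : Nonempty (Fin n) := ⟨v⟩
  obtain ⟨a, ha⟩ := G.exists_minimal_degree_vertex
  obtain ⟨b, hb⟩ := G.exists_maximal_degree_vertex
  have hsa : 0 < Real.sqrt (G.degree a) := Real.sqrt_pos.2 (by exact_mod_cast hd a)
  have hrat : Real.sqrt ((G.maxDegree : ℝ) / (G.minDegree : ℝ)) * Real.sqrt (G.degree a)
      = Real.sqrt (G.degree b) := by
    rw [ha, hb, Real.sqrt_div (by positivity), div_mul_cancel₀ _ hsa.ne']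
  have hsq : ∀ k, ∑ i, (Zmat c₂ G ^ k) i v * (Zmat c₂ G ^ k) i u
      = (Zmat c₂ G ^ (2 * k)) v u := by
    intro k
    rw [two_mul, pow_add, Matrix.mul_apply]
    refine Finset.sum_congr rfl fun i _ => ?_
    congr 1
    rw [← Matrix.transpose_apply (Zmat c₂ G ^ k), Matrix.transpose_pow, hZsymm]
  rw [← mul_le_mul_iff_left₀ hsa]
  calc (∑ i, ‖H i‖) * Real.sqrt (G.degree a)
      ≤ ∑ i, Real.sqrt (G.degree i) * ‖H i‖ := by
        rw [Finset.sum_mul]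
        refine Finset.sum_le_sum fun i _ => ?_
        rw [mul_comm]
        gcongr
        rw [← ha]
        exact G.minDegree_le_degree i
    _ ≤ _ := hH
    _ ≤ ∑ k ∈ Finset.range m, Real.sqrt (G.degree b) * (Zmat c₂ G ^ (2 * (k + 1))) v u := by
        refine Finset.sum_le_sum fun k _ => ?_
        rw [← hsq, Finset.mul_sum]
        refine Finset.sum_le_sum fun i _ => ?_
        refine mul_le_mul_of_nonneg_right ?_ (mul_nonneg (hpow _ _ _) (hpow _ _ _))
        apply Real.sqrt_le_sqrt
        rw [← hb]
        exact_mod_cast G.degree_le_maxDegree i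
    _ = _ := by
        rw [← Finset.mul_sum, ← hrat]; ring
end OSQ
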